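/- arXiv:2504.09162 — 2 statements merged into one kernel-verified Lean document; each statement's English description precedes it below -/
import Mathlib

section
/- Let n ≥ 1, let γ : ℝ → ℝⁿ be smooth and nondegenerate on [-2,2], and let w ∈ C_c^∞(ℝ) with supp w ⊆ [-2,2]. Then there exists a constant C > 0 (depending only on n, γ and w) such that for every ξ ∈ ℝⁿ \ {0}: |∫_ℝ e^{2πi γ(t)·ξ} w(t) dt| ≤ C (1 + H_γ(ξ))^{-1}, where H_γ is the H-functional associated to γ on I = [-2,2]. -/
open MeasureTheory Real Set

/-- The `H`-functional `H_γ(ξ) = inf_{t ∈ I} max_{1 ≤ r ≤ n} |γ^{(r)}(t)·ξ|^{1/r}`. -/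
noncomputable def Hfun (n : ℕ) (γ : ℝ → EuclideanSpace ℝ (Fin n)) (I : Set ℝ)
    (ξ : EuclideanSpace ℝ (Fin n)) : ℝ :=
  sInf ((fun t => ⨆ r : Fin n,
    |∑ i, iteratedDeriv (r.1 + 1) γ t i * ξ i| ^ (((r.1 : ℝ) + 1)⁻¹)) '' I)

/-- `f` has (weakly) constant sign on `[a,b]`. -/
def SgnOn (f : ℝ → ℝ) (a b : ℝ) : Prop :=
  (∀ t ∈ Icc a b, 0 ≤ f t) ∨ (∀ t ∈ Icc a b, f t ≤ 0)

lemma SgnOn.mono {f : ℝ → ℝ} {a b c d : ℝ} (h : SgnOn f a b) (hac : a ≤ c) (hdb : d ≤ b) :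
    SgnOn f c d := by
  rcases h with h | h
  · exact Or.inl fun t ht => h t ⟨hac.trans ht.1, ht.2.trans hdb⟩
  · exact Or.inr fun t ht => h t ⟨hac.trans ht.1, ht.2.trans hdb⟩

lemma exists_cut_mono {f : ℝ → ℝ} (hf : Continuous f) {a b : ℝ} (hab : a ≤ b) (m : ℝ)
    (hm : MonotoneOn f (Icc a b)) :
    ∃ c ∈ Icc a b, (∀ t ∈ Icc c b, m ≤ f t) ∧ (∀ t ∈ Icc a c, f t ≤ m) ∨
      (c = a ∧ ∀ t ∈ Icc a b, m ≤ f t) ∨ (c = b ∧ ∀ t ∈ Icc a b, f t ≤ m) := by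
  rcases le_total m (f a) with h1 | h1
  · refine ⟨a, ⟨le_rfl, hab⟩, Or.inr (Or.inl ⟨rfl, fun t ht => h1.trans (hm ⟨le_rfl, hab⟩ ht ht.1)⟩)⟩
  rcases le_total (f b) m with h2 | h2
  · refine ⟨b, ⟨hab, le_rfl⟩, Or.inr (Or.inr ⟨rfl, fun t ht => (hm ht ⟨hab, le_rfl⟩ ht.2).trans h2⟩)⟩
  obtain ⟨c, hc, hfc⟩ := intermediate_value_Icc hab hf.continuousOn ⟨h1, h2⟩
  refine ⟨c, hc, Or.inl ⟨fun t ht => ?_, fun t ht => ?_⟩⟩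
  · rw [← hfc]; exact hm hc ⟨hc.1.trans ht.1, ht.2⟩ ht.1
  · rw [← hfc]; exact hm ⟨ht.1, ht.2.trans hc.2⟩ hc ht.2

lemma exists_cut_mono' {f : ℝ → ℝ} (hf : Continuous f) {a b : ℝ} (hab : a ≤ b) (m : ℝ)
    (hm : MonotoneOn f (Icc a b)) :
    ∃ c ∈ Icc a b, SgnOn (fun t => f t - m) a c ∧ SgnOn (fun t => f t - m) c b := by
  have single : ∀ x, SgnOn (fun t => f t - m) x x := by
    intro x
    rcases le_total 0 (f x - m) with h | h
    · left; intro t ht; rw [Icc_self] at ht; rw [ht]; exact h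
    · right; intro t ht; rw [Icc_self] at ht; rw [ht]; exact h
  obtain ⟨c, hc, h | ⟨rfl, h⟩ | ⟨rfl, h⟩⟩ := exists_cut_mono hf hab m hm
  · exact ⟨c, hc, Or.inr fun t ht => sub_nonpos.2 (h.2 t ht),
      Or.inl fun t ht => sub_nonneg.2 (h.1 t ht)⟩
  · exact ⟨c, hc, single c, Or.inl fun t ht => sub_nonneg.2 (h t ht)⟩
  · exact ⟨c, hc, Or.inr fun t ht => sub_nonpos.2 (h t ht), single c⟩

lemma SgnOn.neg {f : ℝ → ℝ} {a b : ℝ} (h : SgnOn (fun t => - f t) a b) : SgnOn f a b := by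
  rcases h with h | h
  · exact Or.inr fun t ht => by have := h t ht; simp only at this; linarith
  · exact Or.inl fun t ht => by have := h t ht; simp only at this; linarith

lemma exists_cut {f : ℝ → ℝ} (hf : Differentiable ℝ f) {a b : ℝ} (hab : a ≤ b) (m : ℝ)
    (hs : SgnOn (deriv f) a b) :
    ∃ c ∈ Icc a b, SgnOn (fun t => f t - m) a c ∧ SgnOn (fun t => f t - m) c b := by
  rcases hs with hs | hs
  · apply exists_cut_mono' hf.continuous hab
    apply monotoneOn_of_deriv_nonneg (convex_Icc a b) hf.continuous.continuousOn
      hf.differentiableOn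
    intro x hx; exact hs x (interior_subset hx)
  · have := exists_cut_mono' (f := fun t => - f t) hf.continuous.neg hab (-m) (by
      have h1 : AntitoneOn f (Icc a b) := by
        apply antitoneOn_of_deriv_nonpos (convex_Icc a b) hf.continuous.continuousOn
          hf.differentiableOn
        intro x hx; exact hs x (interior_subset hx)
      exact h1.neg)
    obtain ⟨c, hc, h1, h2⟩ := this
    refine ⟨c, hc, SgnOn.neg ?_, SgnOn.neg ?_⟩
    · convert h1 using 2; ring
    · convert h2 using 2; ring

lemma cut_bound {f : ℝ → ℝ} (hf : Differentiable ℝ f) {g : ℝ → ℂ} (hg : Continuous g)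
    {a b : ℝ} (hab : a ≤ b) (m B : ℝ)
    (hs : SgnOn (deriv f) a b)
    (h : ∀ c d, a ≤ c → c ≤ d → d ≤ b → SgnOn (fun t => f t - m) c d → ‖∫ t in c..d, g t‖ ≤ B) :
    ‖∫ t in a..b, g t‖ ≤ 2 * B := by
  obtain ⟨c, hc, h1, h2⟩ := exists_cut hf hab m hs
  rw [← intervalIntegral.integral_add_adjacent_intervals (hg.intervalIntegrable a c)
    (hg.intervalIntegrable c b)]
  have := h a c le_rfl hc.1 hc.2 h1
  have := h c b hc.1 hc.2 le_rfl h2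
  have := norm_add_le (∫ t in a..c, g t) (∫ t in c..b, g t)
  linarith

lemma cut_bound3 {f : ℝ → ℝ} (hf : Differentiable ℝ f) {g : ℝ → ℂ} (hg : Continuous g)
    {a b : ℝ} (hab : a ≤ b) (m B : ℝ)
    (hs : SgnOn (deriv f) a b)
    (h : ∀ c d, a ≤ c → c ≤ d → d ≤ b → SgnOn f c d →
      ((∀ t ∈ Icc c d, m ≤ |f t|) ∨ (∀ t ∈ Icc c d, |f t| ≤ m)) → ‖∫ t in c..d, g t‖ ≤ B) :
    ‖∫ t in a..b, g t‖ ≤ 8 * B := by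
  have : ‖∫ t in a..b, g t‖ ≤ 2 * (2 * (2 * B)) := by
    refine cut_bound hf hg hab m _ hs fun c d hac hcd hdb s1 => ?_
    refine cut_bound hf hg hcd (-m) _ (hs.mono hac hdb) fun c' d' hac' hcd' hdb' s2 => ?_
    refine cut_bound hf hg hcd' 0 _ (hs.mono (hac.trans hac') (hdb'.trans hdb))
      fun c'' d'' hac'' hcd'' hdb'' s3 => ?_
    have s1 := s1.mono (hac'.trans hac'') (hdb''.trans hdb')
    have s2 := s2.mono hac'' hdb''
    simp only [sub_zero] at s3
    refine h _ _ (hac.trans (hac'.trans hac'')) hcd'' (hdb''.trans (hdb'.trans hdb)) s3 ?_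
    rcases s1 with s1 | s1
    · left; intro t ht; have := s1 t ht; exact le_trans (by linarith) (le_abs_self _)
    rcases s2 with s2 | s2
    · right; intro t ht; have := s1 t ht; have := s2 t ht; rw [abs_le]
      constructor <;> simp only at * <;> linarith
    · left; intro t ht; have := s2 t ht; exact le_trans (by linarith) (neg_le_abs _)
  linarith

/-- First derivative test, general form. -/
lemma vdc_one {φ : ℝ → ℝ} (hφ : ContDiff ℝ (⊤ : ℕ∞) φ) {a b l : ℝ} (hab : a ≤ b) (hl : 0 < l)
    (h : ∀ t ∈ Icc a b, l ≤ |deriv φ t|) :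
    ‖∫ t in a..b, Complex.exp ((φ t : ℂ) * Complex.I)‖ ≤
      2 / l + ∫ t in a..b, |deriv (deriv φ) t / (deriv φ t) ^ 2| := by
  have hne : ∀ t ∈ Icc a b, deriv φ t ≠ 0 := fun t ht h0 => by
    have := h t ht; rw [h0, abs_zero] at this; linarith
  have hd1 : ContDiff ℝ (⊤ : ℕ∞) (deriv φ) := (contDiff_infty_iff_deriv.1 hφ).2
  have hd2 : ContDiff ℝ (⊤ : ℕ∞) (deriv (deriv φ)) := (contDiff_infty_iff_deriv.1 hd1).2
  set u : ℝ → ℂ := fun t => (((deriv φ t)⁻¹ : ℝ) : ℂ) with hu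
  set u' : ℝ → ℂ := fun t => ((-(deriv (deriv φ) t) / (deriv φ t) ^ 2 : ℝ) : ℂ) with hu'
  set v : ℝ → ℂ := fun t => Complex.exp ((φ t : ℂ) * Complex.I) * (-Complex.I) with hv
  set v' : ℝ → ℂ := fun t => Complex.exp ((φ t : ℂ) * Complex.I) * ((deriv φ t : ℝ) : ℂ) with hv'
  have huI : uIcc a b = Icc a b := uIcc_of_le hab
  have hdu : ∀ x ∈ uIcc a b, HasDerivAt u (u' x) x := by
    intro x hx
    rw [huI] at hx
    have h1 : HasDerivAt (deriv φ) (deriv (deriv φ) x) x :=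
      (hd1.differentiable (by simp) x).hasDerivAt
    exact (h1.fun_inv (hne x hx)).ofReal_comp
  have hdv : ∀ x ∈ uIcc a b, HasDerivAt v (v' x) x := by
    intro x hx
    have h1 : HasDerivAt φ (deriv φ x) x := (hφ.differentiable (by simp) x).hasDerivAt
    have h2 := ((h1.ofReal_comp.mul_const Complex.I).cexp).mul_const (-Complex.I)
    refine h2.congr_deriv ?_
    simp only [hv']
    linear_combination (-Complex.exp ((φ x : ℂ) * Complex.I) * ((deriv φ x : ℝ) : ℂ)) *
      Complex.I_mul_I
  have hcu' : ContinuousOn (fun t => -(deriv (deriv φ) t) / (deriv φ t) ^ 2) (Icc a b) := by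
    apply ContinuousOn.div (hd2.continuous.neg.continuousOn) (hd1.continuous.pow 2).continuousOn
    intro t ht; exact pow_ne_zero _ (hne t ht)
  have hiu' : IntervalIntegrable u' volume a b := by
    apply ContinuousOn.intervalIntegrable
    rw [huI]
    exact Complex.continuous_ofReal.comp_continuousOn hcu'
  have hiv' : IntervalIntegrable v' volume a b := by
    apply Continuous.intervalIntegrable
    have := hφ.continuous
    have := hd1.continuous
    fun_prop
  have hparts := intervalIntegral.integral_mul_deriv_eq_deriv_mul hdu hdv hiu' hiv'
  have heq : ∫ t in a..b, Complex.exp ((φ t : ℂ) * Complex.I) = ∫ t in a..b, u t * v' t := by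
    apply intervalIntegral.integral_congr
    intro t ht
    rw [huI] at ht
    have : ((deriv φ t : ℝ) : ℂ) ≠ 0 := by exact_mod_cast hne t ht
    simp only [hu, hv', Complex.ofReal_inv]
    field_simp
  have hvn : ∀ t, ‖v t‖ = 1 := by
    intro t; simp only [hv, norm_mul, norm_neg, Complex.norm_I, Complex.norm_exp_ofReal_mul_I, mul_one]
  have hun : ∀ t ∈ Icc a b, ‖u t‖ ≤ 1 / l := by
    intro t ht
    simp only [hu, Complex.norm_real, norm_inv, Real.norm_eq_abs]
    rw [one_div]
    exact inv_anti₀ hl (h t ht)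
  rw [heq, hparts]
  have h1 : ‖u b * v b‖ ≤ 1 / l := by rw [norm_mul, hvn, mul_one]; exact hun b ⟨hab, le_rfl⟩
  have h2 : ‖u a * v a‖ ≤ 1 / l := by rw [norm_mul, hvn, mul_one]; exact hun a ⟨le_rfl, hab⟩
  have h3 : ‖∫ t in a..b, u' t * v t‖ ≤ ∫ t in a..b, |deriv (deriv φ) t / (deriv φ t) ^ 2| := by
    refine (intervalIntegral.norm_integral_le_integral_norm hab).trans (le_of_eq ?_)
    apply intervalIntegral.integral_congr
    intro t ht
    simp only [norm_mul, hvn, mul_one, hu', Complex.norm_real, Real.norm_eq_abs, neg_div, abs_neg]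
  have h4 := norm_sub_le (u b * v b - u a * v a) (∫ t in a..b, u' t * v t)
  have h5 := norm_sub_le (u b * v b) (u a * v a)
  have : 2 / l = 1 / l + 1 / l := by ring
  linarith

/-- First derivative test with monotone derivative. -/
lemma vdc_one_sgn {φ : ℝ → ℝ} (hφ : ContDiff ℝ (⊤ : ℕ∞) φ) {a b l : ℝ} (hab : a ≤ b) (hl : 0 < l)
    (h : ∀ t ∈ Icc a b, l ≤ |deriv φ t|) (hs : SgnOn (deriv (deriv φ)) a b) :
    ‖∫ t in a..b, Complex.exp ((φ t : ℂ) * Complex.I)‖ ≤ 4 / l := by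
  have hne : ∀ t ∈ Icc a b, deriv φ t ≠ 0 := fun t ht h0 => by
    have := h t ht; rw [h0, abs_zero] at this; linarith
  have hd1 : ContDiff ℝ (⊤ : ℕ∞) (deriv φ) := (contDiff_infty_iff_deriv.1 hφ).2
  have hd2 : ContDiff ℝ (⊤ : ℕ∞) (deriv (deriv φ)) := (contDiff_infty_iff_deriv.1 hd1).2
  have huI : uIcc a b = Icc a b := uIcc_of_le hab
  have hun : ∀ t ∈ Icc a b, |(deriv φ t)⁻¹| ≤ 1 / l := by
    intro t ht
    rw [one_div, abs_inv]
    exact inv_anti₀ hl (h t ht)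
  have hftc : ∫ t in a..b, -(deriv (deriv φ) t) / (deriv φ t) ^ 2 =
      (deriv φ b)⁻¹ - (deriv φ a)⁻¹ := by
    apply intervalIntegral.integral_eq_sub_of_hasDerivAt (f := fun t => (deriv φ t)⁻¹)
    · intro x hx
      rw [huI] at hx
      have h1 : HasDerivAt (deriv φ) (deriv (deriv φ) x) x :=
        (hd1.differentiable (by simp) x).hasDerivAt
      exact h1.fun_inv (hne x hx)
    · apply ContinuousOn.intervalIntegrable
      rw [huI]
      apply ContinuousOn.div (hd2.continuous.neg.continuousOn) (hd1.continuous.pow 2).continuousOn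
      intro t ht; exact pow_ne_zero _ (hne t ht)
  have key : ∫ t in a..b, |deriv (deriv φ) t / (deriv φ t) ^ 2| ≤ 2 / l := by
    have ha := abs_le.1 (hun a ⟨le_rfl, hab⟩)
    have hb := abs_le.1 (hun b ⟨hab, le_rfl⟩)
    have h2l : 2 / l = 1 / l + 1 / l := by ring
    rcases hs with hs | hs
    · have : ∫ t in a..b, |deriv (deriv φ) t / (deriv φ t) ^ 2| =
        - ∫ t in a..b, -(deriv (deriv φ) t) / (deriv φ t) ^ 2 := by
        rw [← intervalIntegral.integral_neg]
        apply intervalIntegral.integral_congr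
        intro t ht
        rw [huI] at ht
        simp only
        rw [abs_of_nonneg (div_nonneg (hs t ht) (sq_nonneg _))]
        ring
      rw [this, hftc]; linarith
    · have : ∫ t in a..b, |deriv (deriv φ) t / (deriv φ t) ^ 2| =
        ∫ t in a..b, -(deriv (deriv φ) t) / (deriv φ t) ^ 2 := by
        apply intervalIntegral.integral_congr
        intro t ht
        rw [huI] at ht
        simp only
        rw [abs_of_nonpos (div_nonpos_of_nonpos_of_nonneg (hs t ht) (sq_nonneg _))]
        ring
      rw [this, hftc]; linarith
  have := vdc_one hφ hab hl h
  have h4 : 4 / l = 2 / l + 2 / l := by ring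
  linarith

lemma contDiff_iter {φ : ℝ → ℝ} (hφ : ContDiff ℝ (⊤ : ℕ∞) φ) (k : ℕ) :
    ContDiff ℝ (⊤ : ℕ∞) (iteratedDeriv k φ) := by
  induction k with
  | zero => simpa using hφ
  | succ k ih => rw [iteratedDeriv_succ]; exact (contDiff_infty_iff_deriv.1 ih).2

lemma sgnOn_of_ne {f : ℝ → ℝ} (hf : Continuous f) {a b : ℝ}
    (h : ∀ t ∈ Icc a b, f t ≠ 0) : SgnOn f a b := by
  by_contra hcon
  unfold SgnOn at hcon
  push Not at hcon
  obtain ⟨⟨x, hx, hfx⟩, ⟨y, hy, hfy⟩⟩ := hcon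
  obtain ⟨z, hz, hfz⟩ := isPreconnected_Icc.intermediate_value hx hy hf.continuousOn
    ⟨hfx.le, hfy.le⟩
  exact h z hz hfz

/-- Trivial bound for the oscillatory integral. -/
lemma triv_bound (φ : ℝ → ℝ) {a b : ℝ} (hab : a ≤ b) :
    ‖∫ t in a..b, Complex.exp ((φ t : ℂ) * Complex.I)‖ ≤ b - a := by
  have := intervalIntegral.norm_integral_le_of_norm_le_const (a := a) (b := b) (C := 1)
    (f := fun t => Complex.exp ((φ t : ℂ) * Complex.I)) (fun t _ => by
      rw [Complex.norm_exp_ofReal_mul_I])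
  rwa [one_mul, abs_of_nonneg (by linarith)] at this

lemma cont_osc {φ : ℝ → ℝ} (hφ : ContDiff ℝ (⊤ : ℕ∞) φ) :
    Continuous fun t => Complex.exp ((φ t : ℂ) * Complex.I) := by
  have := hφ.continuous
  fun_prop

/-- van der Corput. -/
lemma vdc (k : ℕ) : ∃ C : ℝ, 0 < C ∧ ∀ φ : ℝ → ℝ, ContDiff ℝ (⊤ : ℕ∞) φ → ∀ a b H : ℝ, a ≤ b →
    0 < H → (∀ t ∈ Icc a b, H ^ (k + 1) ≤ |iteratedDeriv (k + 1) φ t|) →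
    (k = 0 → SgnOn (iteratedDeriv 2 φ) a b) →
    ‖∫ t in a..b, Complex.exp ((φ t : ℂ) * Complex.I)‖ ≤ C / H := by
  induction k with
  | zero =>
    refine ⟨4, by norm_num, fun φ hφ a b H hab hH h hs => ?_⟩
    refine vdc_one_sgn hφ hab hH ?_ ?_
    · simpa [iteratedDeriv_one] using h
    · have := hs rfl
      rwa [iteratedDeriv_succ, iteratedDeriv_one] at this
  | succ k ih =>
    obtain ⟨C, hC, ih⟩ := ih
    refine ⟨8 * (C + 2), by positivity, fun φ hφ a b H hab hH h _ => ?_⟩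
    have hdf := (contDiff_iter hφ (k + 1)).differentiable (by simp)
    have hds : deriv (iteratedDeriv (k + 1) φ) = iteratedDeriv (k + 2) φ :=
      iteratedDeriv_succ.symm
    have hs : SgnOn (iteratedDeriv (k + 2) φ) a b :=
      sgnOn_of_ne (contDiff_iter hφ _).continuous fun t ht h0 => by
        have := h t ht
        rw [h0, abs_zero] at this
        have : 0 < H ^ (k + 1 + 1) := by positivity
        linarith
    have : 8 * (C + 2) / H = 8 * (C / H + 2 / H) := by ring
    rw [this]
    refine cut_bound3 hdf (cont_osc hφ) hab (H ^ (k + 1)) _ (hds ▸ hs) ?_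
    intro c d hac hcd hdb _ hcase
    have hCH : 0 < C / H := by positivity
    have h2H : 0 < 2 / H := by positivity
    rcases hcase with hc | hc
    · have := ih φ hφ c d H hcd hH hc (fun hk => by subst hk; exact hs.mono hac hdb)
      linarith
    · have htriv := triv_bound φ hcd
      suffices d - c ≤ 2 / H by linarith
      rcases hcd.eq_or_lt with rfl | hlt
      · simpa using h2H.le
      obtain ⟨x, hx, hxe⟩ := exists_deriv_eq_slope (iteratedDeriv (k + 1) φ) hlt
        hdf.continuous.continuousOn hdf.differentiableOn
      rw [hds] at hxe
      have h1 := h x ⟨hac.trans hx.1.le, hx.2.le.trans hdb⟩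
      rw [hxe, abs_div, abs_of_pos (sub_pos.2 hlt), le_div_iff₀ (sub_pos.2 hlt)] at h1
      have h2 := hc c ⟨le_rfl, hcd⟩
      have h3 := hc d ⟨hcd, le_rfl⟩
      have h4 := abs_sub (iteratedDeriv (k + 1) φ d) (iteratedDeriv (k + 1) φ c)
      rw [le_div_iff₀ hH]
      have hp : 0 < H ^ (k + 1) := by positivity
      have : H ^ (k + 1) * ((d - c) * H) ≤ H ^ (k + 1) * 2 := by
        calc _ = H ^ (k + 1 + 1) * (d - c) := by ring
          _ ≤ _ := h1
          _ ≤ _ := h4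
          _ ≤ _ := by linarith
      exact le_of_mul_le_mul_left this hp

/-- Multi-derivative version. -/
lemma multi (k : ℕ) : ∃ C : ℝ, 0 < C ∧ ∀ φ : ℝ → ℝ, ContDiff ℝ (⊤ : ℕ∞) φ → ∀ a b H : ℝ, a ≤ b →
    0 < H → SgnOn (iteratedDeriv (k + 1) φ) a b →
    (∀ t ∈ Icc a b, ∃ r < k, H ^ (r + 1) ≤ |iteratedDeriv (r + 1) φ t|) →
    ‖∫ t in a..b, Complex.exp ((φ t : ℂ) * Complex.I)‖ ≤ C / H := by
  induction k with
  | zero =>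
    refine ⟨1, one_pos, fun φ hφ a b H hab hH _ h => ?_⟩
    obtain ⟨r, hr, _⟩ := h a ⟨le_rfl, hab⟩
    omega
  | succ k ih =>
    obtain ⟨C, hC, ih⟩ := ih
    obtain ⟨V, hV, vd⟩ := vdc k
    refine ⟨8 * (C + 2 * V), by positivity, fun φ hφ a b H hab hH hs h => ?_⟩
    have hdf := (contDiff_iter hφ (k + 1)).differentiable (by simp)
    have hds : deriv (iteratedDeriv (k + 1) φ) = iteratedDeriv (k + 2) φ :=
      iteratedDeriv_succ.symm
    have : 8 * (C + 2 * V) / H = 8 * (C / H + V / (H / 2)) := by field_simp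
    rw [this]
    refine cut_bound3 hdf (cont_osc hφ) hab ((H / 2) ^ (k + 1)) _ (hds ▸ hs) ?_
    intro c d hac hcd hdb hsg hcase
    have hCH : 0 < C / H := by positivity
    have h2H : 0 < V / (H / 2) := by positivity
    rcases hcase with hc | hc
    · have := vd φ hφ c d (H / 2) hcd (by positivity) hc
        (fun hk => by subst hk; exact hs.mono hac hdb)
      linarith
    · have := ih φ hφ c d H hcd hH hsg (fun t ht => by
        obtain ⟨r, hr, hle⟩ := h t ⟨hac.trans ht.1, ht.2.trans hdb⟩
        refine ⟨r, ?_, hle⟩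
        rcases Nat.lt_succ_iff_lt_or_eq.1 hr with h' | rfl
        · exact h'
        · exfalso
          have h1 := hc t ht
          have h2 : (H / 2) ^ (r + 1) < H ^ (r + 1) :=
            pow_lt_pow_left₀ (by linarith) (by positivity) (by omega)
          linarith)
      linarith

lemma short_bound (n : ℕ) (K c : ℝ) (hK : 0 < K) (hc : 0 < c) :
    ∃ δ > 0, ∃ C > 0, ∀ ψ : ℝ → ℝ, ContDiff ℝ (⊤ : ℕ∞) ψ → ∀ X H : ℝ, 0 ≤ X → 1 ≤ H →
    (∀ t ∈ Icc (-2 : ℝ) 2, ∀ r ≤ n, |iteratedDeriv (r + 1) ψ t| ≤ K * X) →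
    (∀ t ∈ Icc (-2 : ℝ) 2, ∃ r < n, c * X ≤ |iteratedDeriv (r + 1) ψ t|) →
    (∀ t ∈ Icc (-2 : ℝ) 2, ∃ r < n, H ^ (r + 1) ≤ |iteratedDeriv (r + 1) ψ t|) →
    ∀ a b : ℝ, -2 ≤ a → a ≤ b → b ≤ 2 → b - a ≤ δ →
    ‖∫ t in a..b, Complex.exp ((ψ t : ℂ) * Complex.I)‖ ≤ C / H := by
  choose Cm hCm multi' using multi
  choose Cv hCv vdc' using vdc
  set ε : ℝ := min 1 (c / (2 * K)) with hε
  have hε0 : 0 < ε := lt_min one_pos (by positivity)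
  have hε1 : ε ≤ 1 := min_le_left _ _
  have hε2 : ε * K ≤ c / 2 := by
    have : ε ≤ c / (2 * K) := min_le_right _ _
    rw [le_div_iff₀ (by positivity)] at this
    linarith
  set C1 : ℝ := 4 * K / c + 16 * K ^ 2 / c ^ 2 with hC1
  have hC1p : 0 < C1 := by positivity
  set S : ℝ := ∑ k ∈ Finset.range n, (Cm k + Cv k / ε) with hS
  have hSnn : ∀ k, 0 < Cm k + Cv k / ε := fun k =>
    add_pos (hCm k) (div_pos (hCv k) hε0)
  have hSk : ∀ k < n, Cm k + Cv k / ε ≤ S := fun k hk =>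
    Finset.single_le_sum (f := fun k => Cm k + Cv k / ε) (fun i _ => (hSnn i).le)
      (Finset.mem_range.2 hk)
  have hS0 : 0 ≤ S := Finset.sum_nonneg fun i _ => (hSnn i).le
  refine ⟨c / (2 * K), by positivity, S + C1, by positivity, ?_⟩
  intro ψ hψ X H hX hH hup hlow hHr a b ha hab hb hδ
  have hH0 : 0 < H := by linarith
  have hsub : ∀ t ∈ Icc a b, t ∈ Icc (-2 : ℝ) 2 := fun t ht => ⟨ha.trans ht.1, ht.2.trans hb⟩
  have haI : a ∈ Icc a b := ⟨le_rfl, hab⟩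
  obtain ⟨k, hk, hka⟩ := hlow a (hsub a haI)
  have hlb : ∀ t ∈ Icc a b, c / 2 * X ≤ |iteratedDeriv (k + 1) ψ t| := by
    intro t ht
    have hmv := (convex_Icc a b).norm_image_sub_le_of_norm_deriv_le
      (f := iteratedDeriv (k + 1) ψ) (C := K * X)
      (fun x _ => (contDiff_iter hψ (k + 1)).differentiable (by simp) x)
      (fun x hx => by
        have h1 : deriv (iteratedDeriv (k + 1) ψ) = iteratedDeriv (k + 1 + 1) ψ :=
          iteratedDeriv_succ.symm
        rw [h1, Real.norm_eq_abs]
        exact hup x (hsub x hx) (k + 1) hk) haI ht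
    rw [Real.norm_eq_abs, Real.norm_eq_abs, abs_of_nonneg (sub_nonneg.2 ht.1)] at hmv
    have h1 : K * X * (t - a) ≤ K * X * (c / (2 * K)) :=
      mul_le_mul_of_nonneg_left (by linarith [ht.2]) (by positivity)
    have h2 : K * X * (c / (2 * K)) = c / 2 * X := by field_simp
    have h3 := abs_sub_abs_le_abs_sub (iteratedDeriv (k + 1) ψ a) (iteratedDeriv (k + 1) ψ t)
    rw [abs_sub_comm] at h3
    linarith
  have hbd : ∀ x, x ≤ Cm k / H + Cv k / (ε * H) + C1 / H → x ≤ (S + C1) / H := by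
    intro x hx
    have h1 : Cm k / H + Cv k / (ε * H) + C1 / H = (Cm k + Cv k / ε + C1) / H := by
      field_simp
    rw [h1] at hx
    refine hx.trans ?_
    have := hSk k hk
    gcongr
  apply hbd
  have q1 : 0 < Cm k / H := div_pos (hCm k) hH0
  have q2 : 0 < Cv k / (ε * H) := div_pos (hCv k) (by positivity)
  have q3 : 0 < C1 / H := by positivity
  by_cases hall : ∀ t ∈ Icc a b, ∃ r < k, H ^ (r + 1) ≤ |iteratedDeriv (r + 1) ψ t|
  · have hXpos : 0 < X := by
      rcases hX.eq_or_lt with h0 | h0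
      · exfalso
        obtain ⟨r, hr, hle⟩ := hall a haI
        have h1 := hup a (hsub a haI) r (by omega)
        have h2 : 0 < H ^ (r + 1) := by positivity
        rw [← h0] at h1
        linarith
      · exact h0
    have hsg : SgnOn (iteratedDeriv (k + 1) ψ) a b :=
      sgnOn_of_ne (contDiff_iter hψ _).continuous fun t ht h0 => by
        have := hlb t ht
        rw [h0, abs_zero] at this
        have : 0 < c / 2 * X := by positivity
        linarith
    have := multi' k ψ hψ a b H hab hH0 hsg hall
    linarith
  · push Not at hall
    obtain ⟨t, ht, hts⟩ := hall
    obtain ⟨r, hr, hrt⟩ := hHr t (hsub t ht)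
    have hkr : k ≤ r := by
      by_contra hcon
      have := hts r (by omega)
      linarith
    have hHK : H ^ (k + 1) ≤ K * X :=
      (pow_le_pow_right₀ hH (by omega)).trans (hrt.trans (hup t (hsub t ht) r hr.le))
    have hXpos : 0 < X := by
      have h2 : 0 < H ^ (k + 1) := by positivity
      have h3 : 0 < K * X := by linarith
      exact pos_of_mul_pos_right h3 hK.le
    rcases Nat.eq_zero_or_pos k with hk0 | hk0
    · subst hk0
      simp only [zero_add, pow_one] at hHK
      have hl : 0 < c / 2 * X := by positivity
      have h1 := vdc_one hψ hab hl (by simpa [iteratedDeriv_one] using hlb)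
      have h2 : ∫ t in a..b, |deriv (deriv ψ) t / (deriv ψ t) ^ 2| ≤
          K * X / (c / 2 * X) ^ 2 * (b - a) := by
        have := intervalIntegral.norm_integral_le_of_norm_le_const (a := a) (b := b)
          (C := K * X / (c / 2 * X) ^ 2) (f := fun t => |deriv (deriv ψ) t / (deriv ψ t) ^ 2|)
          (fun s hs => by
            rw [uIoc_of_le hab] at hs
            have hs' : s ∈ Icc a b := ⟨hs.1.le, hs.2⟩
            have e1 := hup s (hsub s hs') 1 hk
            have e2 := hlb s hs'
            simp only [zero_add, iteratedDeriv_one] at e2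
            rw [iteratedDeriv_succ, iteratedDeriv_one] at e1
            rw [Real.norm_eq_abs, abs_abs, abs_div, abs_pow]
            gcongr)
        rw [abs_of_nonneg (by linarith)] at this
        exact (le_abs_self _).trans this
      have h3 : K * X / (c / 2 * X) ^ 2 * (b - a) ≤ K * X / (c / 2 * X) ^ 2 * 4 :=
        mul_le_mul_of_nonneg_left (by linarith) (by positivity)
      have h4 : 2 / (c / 2 * X) + K * X / (c / 2 * X) ^ 2 * 4 = C1 / (K * X) := by
        rw [hC1]; field_simp; ring
      have h5 : C1 / (K * X) ≤ C1 / H := by gcongr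
      linarith
    · have h1 := vdc' k ψ hψ a b (ε * H) hab (by positivity) (fun s hs => by
        refine le_trans ?_ (hlb s hs)
        rw [mul_pow]
        calc ε ^ (k + 1) * H ^ (k + 1) ≤ ε * (K * X) := by
              gcongr
              exact pow_le_of_le_one hε0.le hε1 (by omega)
          _ = ε * K * X := by ring
          _ ≤ c / 2 * X := by gcongr) (fun h => by omega)
      linarith

lemma long_bound {g : ℝ → ℂ} (hg : Continuous g) {δ B : ℝ} (hδ : 0 < δ) (hB : 0 ≤ B)
    (h : ∀ a b : ℝ, -2 ≤ a → a ≤ b → b ≤ 2 → b - a ≤ δ → ‖∫ t in a..b, g t‖ ≤ B) (m : ℕ) :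
    ∀ b : ℝ, -2 ≤ b → b ≤ 2 → b + 2 ≤ m * δ → ‖∫ t in (-2 : ℝ)..b, g t‖ ≤ m * B := by
  induction m with
  | zero =>
    intro b h1 h2 h3
    have : b = -2 := by simp at h3; linarith
    simp [this]
  | succ m ih =>
    intro b h1 h2 h3
    push_cast at h3 ⊢
    rcases le_total (b + 2) (m * δ) with h4 | h4
    · have := ih b h1 h2 h4; linarith
    · set c : ℝ := max (-2) (b - δ) with hcdef
      have c1 : -2 ≤ c := le_max_left _ _
      have c2 : c ≤ b := max_le h1 (by linarith)
      have c3 : b - δ ≤ c := le_max_right _ _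
      have c4 : c + 2 ≤ m * δ := by
        have : c ≤ m * δ - 2 := max_le (by have : 0 ≤ (m : ℝ) * δ := by positivity
                                           linarith) (by linarith)
        linarith
      have e1 := ih c c1 (c2.trans h2) c4
      have e2 := h c b c1 c2 h2 (by linarith)
      rw [← intervalIntegral.integral_add_adjacent_intervals (hg.intervalIntegrable (-2) c)
        (hg.intervalIntegrable c b)]
      have := norm_add_le (∫ t in (-2 : ℝ)..c, g t) (∫ t in c..b, g t)
      linarith

lemma weight_bound {g : ℝ → ℂ} (hg : Continuous g) {w : ℝ → ℝ} (hw : ContDiff ℝ (⊤ : ℕ∞) w)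
    (hwsupp : tsupport w ⊆ Set.Icc (-2 : ℝ) 2) {B : ℝ}
    (h : ∀ b : ℝ, -2 ≤ b → b ≤ 2 → ‖∫ t in (-2 : ℝ)..b, g t‖ ≤ B) :
    ‖∫ t : ℝ, g t * (w t : ℂ)‖ ≤ B * (|w 2| + ∫ t in (-2 : ℝ)..2, |deriv w t|) := by
  have h22 : (-2 : ℝ) ≤ 2 := by norm_num
  have hd : Continuous (deriv w) := ((contDiff_infty_iff_deriv.1 hw).2).continuous
  have e1 : ∫ t : ℝ, g t * (w t : ℂ) = ∫ t in (-2 : ℝ)..2, (w t : ℂ) * g t := by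
    rw [intervalIntegral.integral_of_le h22, ← integral_Icc_eq_integral_Ioc]
    rw [setIntegral_eq_integral_of_forall_compl_eq_zero]
    · congr 1; ext t; ring
    · intro t ht
      have : w t = 0 := image_eq_zero_of_notMem_tsupport fun h => ht (hwsupp h)
      simp [this]
  have hparts := intervalIntegral.integral_mul_deriv_eq_deriv_mul (a := (-2 : ℝ)) (b := 2)
    (u := fun t => (w t : ℂ)) (u' := fun t => ((deriv w t : ℝ) : ℂ))
    (v := fun t => ∫ s in (-2 : ℝ)..t, g s) (v' := g)
    (fun x _ => ((hw.differentiable (by simp) x).hasDerivAt).ofReal_comp)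
    (fun x _ => intervalIntegral.integral_hasDerivAt_right (hg.intervalIntegrable _ _)
      (hg.stronglyMeasurableAtFilter _ _) hg.continuousAt)
    ((Complex.continuous_ofReal.comp hd).intervalIntegrable _ _) (hg.intervalIntegrable _ _)
  rw [e1, hparts]
  simp only [intervalIntegral.integral_same, mul_zero, sub_zero]
  have f1 : ‖(w 2 : ℂ) * ∫ s in (-2 : ℝ)..2, g s‖ ≤ |w 2| * B := by
    rw [norm_mul, Complex.norm_real, Real.norm_eq_abs]
    exact mul_le_mul_of_nonneg_left (h 2 h22 le_rfl) (abs_nonneg _)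
  have f2 : ‖∫ t in (-2 : ℝ)..2, ((deriv w t : ℝ) : ℂ) * ∫ s in (-2 : ℝ)..t, g s‖ ≤
      ∫ t in (-2 : ℝ)..2, |deriv w t| * B := by
    apply intervalIntegral.norm_integral_le_of_norm_le h22
    · refine Filter.Eventually.of_forall fun t ht => ?_
      rw [norm_mul, Complex.norm_real, Real.norm_eq_abs]
      exact mul_le_mul_of_nonneg_left (h t ht.1.le ht.2) (abs_nonneg _)
    · exact (hd.abs.mul continuous_const).intervalIntegrable _ _
  rw [intervalIntegral.integral_mul_const] at f2
  have := norm_sub_le ((w 2 : ℂ) * ∫ s in (-2 : ℝ)..2, g s)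
    (∫ t in (-2 : ℝ)..2, ((deriv w t : ℝ) : ℂ) * ∫ s in (-2 : ℝ)..t, g s)
  linarith

lemma sum_eq_inner {n : ℕ} (x ξ : EuclideanSpace ℝ (Fin n)) :
    ∑ i, x i * ξ i = inner ℝ ξ x := by
  simp [PiLp.inner_apply]

lemma iter_phase {n : ℕ} {γ : ℝ → EuclideanSpace ℝ (Fin n)} (hγ : ContDiff ℝ (⊤ : ℕ∞) γ)
    (ξ : EuclideanSpace ℝ (Fin n)) (r : ℕ) :
    iteratedDeriv r (fun t => 2 * Real.pi * ∑ i, γ t i * ξ i) =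
      fun t => 2 * Real.pi * ∑ i, iteratedDeriv r γ t i * ξ i := by
  induction r with
  | zero => simp
  | succ r ih =>
    rw [iteratedDeriv_succ, ih]
    ext t
    simp only [sum_eq_inner]
    have hdiff : Differentiable ℝ (iteratedDeriv r γ) :=
      hγ.differentiable_iteratedDeriv r (by exact_mod_cast WithTop.coe_lt_top r)
    have h1 := (hdiff t).hasDerivAt
    rw [← iteratedDeriv_succ] at h1
    have h2 := ((innerSL ℝ ξ).hasFDerivAt.comp_hasDerivAt t h1).const_mul (2 * Real.pi)
    exact h2.deriv

lemma upper_const {n : ℕ} {γ : ℝ → EuclideanSpace ℝ (Fin n)} (hγ : ContDiff ℝ (⊤ : ℕ∞) γ) :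
    ∃ K > 0, ∀ t ∈ Icc (-2 : ℝ) 2, ∀ r ≤ n, ‖iteratedDeriv (r + 1) γ t‖ ≤ K := by
  have hc : Continuous fun t => ∑ r ∈ Finset.range (n + 1), ‖iteratedDeriv (r + 1) γ t‖ :=
    continuous_finsetSum _ fun r _ =>
      (hγ.continuous_iteratedDeriv (r + 1) (by exact_mod_cast le_top)).norm
  obtain ⟨K, hK⟩ := isCompact_Icc.exists_bound_of_continuousOn (s := Icc (-2 : ℝ) 2) hc.continuousOn
  refine ⟨max K 1, by positivity, fun t ht r hr => ?_⟩
  refine le_trans ?_ (((le_abs_self _).trans (hK t ht)).trans (le_max_left _ _))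
  exact Finset.single_le_sum (f := fun r => ‖iteratedDeriv (r + 1) γ t‖)
    (fun _ _ => norm_nonneg _) (Finset.mem_range.2 (by omega))

lemma lower_const {n : ℕ} (hn : 1 ≤ n) {γ : ℝ → EuclideanSpace ℝ (Fin n)}
    (hγ : ContDiff ℝ (⊤ : ℕ∞) γ)
    (hnondeg : ∀ t ∈ Set.Icc (-2 : ℝ) 2,
      (Matrix.of fun (i r : Fin n) => iteratedDeriv (r.1 + 1) γ t i).det ≠ 0) :
    ∃ c > 0, ∀ t ∈ Icc (-2 : ℝ) 2, ∀ ξ : EuclideanSpace ℝ (Fin n), ∃ r < n,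
      c * ‖ξ‖ ≤ |∑ i, iteratedDeriv (r + 1) γ t i * ξ i| := by
  have hcomp : IsCompact (Icc (-2 : ℝ) 2 ×ˢ Metric.sphere (0 : EuclideanSpace ℝ (Fin n)) 1) :=
    isCompact_Icc.prod (isCompact_sphere _ _)
  set G : ℝ × EuclideanSpace ℝ (Fin n) → ℝ := fun p =>
    ∑ r : Fin n, |inner ℝ p.2 (iteratedDeriv (r.1 + 1) γ p.1)| with hG
  have hcont : Continuous G := by
    refine continuous_finsetSum _ fun r _ => Continuous.abs ?_
    have := hγ.continuous_iteratedDeriv (r.1 + 1) (by exact_mod_cast le_top)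
    fun_prop
  have hpos : ∀ p ∈ Icc (-2 : ℝ) 2 ×ˢ Metric.sphere (0 : EuclideanSpace ℝ (Fin n)) 1, 0 < G p := by
    rintro ⟨t, ξ⟩ ⟨ht, hξ⟩
    refine lt_of_le_of_ne (Finset.sum_nonneg fun _ _ => abs_nonneg _) fun h0 => ?_
    have h1 := (Finset.sum_eq_zero_iff_of_nonneg (fun _ _ => abs_nonneg _)).1 h0.symm
    have h2 : (fun i => ξ i) = 0 := by
      apply Matrix.eq_zero_of_vecMul_eq_zero (hnondeg t ht)
      ext r
      have := abs_eq_zero.1 (h1 r (Finset.mem_univ r))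
      rw [← sum_eq_inner] at this
      simp only [Matrix.vecMul, dotProduct, Matrix.of_apply, Pi.zero_apply]
      rw [← this]
      exact Finset.sum_congr rfl fun i _ => mul_comm _ _
    have h3 : ξ = 0 := by
      ext i; exact congrFun h2 i
    simp [h3] at hξ
  have hnpos : (0 : ℝ) < n := by exact_mod_cast hn
  have : ∃ c0 > 0, ∀ p ∈ Icc (-2 : ℝ) 2 ×ˢ Metric.sphere (0 : EuclideanSpace ℝ (Fin n)) 1,
      c0 ≤ G p := by
    rcases (Icc (-2 : ℝ) 2 ×ˢ Metric.sphere (0 : EuclideanSpace ℝ (Fin n)) 1).eq_empty_or_nonempty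
      with he | hne
    · exact ⟨1, one_pos, fun p hp => by rw [he] at hp; exact hp.elim⟩
    · obtain ⟨p, hp, hmin⟩ := hcomp.exists_isMinOn hne hcont.continuousOn
      exact ⟨G p, hpos p hp, fun q hq => hmin hq⟩
  obtain ⟨c0, hc0, hmin⟩ := this
  refine ⟨c0 / n, by positivity, fun t ht ξ => ?_⟩
  by_cases hξ : ξ = 0
  · exact ⟨0, hn, by simp [hξ]⟩
  have hξn : 0 < ‖ξ‖ := norm_pos_iff.2 hξ
  by_contra hcon
  push Not at hcon
  have h1 := hmin (t, ‖ξ‖⁻¹ • ξ) ⟨ht, by simp [norm_smul, hξn.ne']⟩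
  have h2 : G (t, ‖ξ‖⁻¹ • ξ) = ‖ξ‖⁻¹ * ∑ r : Fin n, |inner ℝ ξ (iteratedDeriv (r.1 + 1) γ t)| := by
    simp only [hG, real_inner_smul_left, abs_mul, abs_inv, abs_norm, Finset.mul_sum]
  have h3 : ∑ r : Fin n, |inner ℝ ξ (iteratedDeriv (r.1 + 1) γ t)| < ∑ r : Fin n, c0 / n * ‖ξ‖ := by
    apply Finset.sum_lt_sum_of_nonempty
    · exact ⟨⟨0, hn⟩, Finset.mem_univ _⟩
    · intro r _
      have := hcon r.1 r.2
      rwa [sum_eq_inner] at this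
  rw [Finset.sum_const, Finset.card_univ, Fintype.card_fin, nsmul_eq_mul] at h3
  have h4 : (n : ℝ) * (c0 / n * ‖ξ‖) = c0 * ‖ξ‖ := by field_simp
  rw [h4] at h3
  rw [h2] at h1
  have h5 := mul_lt_mul_of_pos_left h3 (inv_pos.2 hξn)
  have h6 : ‖ξ‖⁻¹ * (c0 * ‖ξ‖) = c0 := by field_simp
  linarith

lemma Hfun_nonneg (n : ℕ) (γ : ℝ → EuclideanSpace ℝ (Fin n)) (I : Set ℝ)
    (ξ : EuclideanSpace ℝ (Fin n)) : 0 ≤ Hfun n γ I ξ := by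
  apply Real.sInf_nonneg
  rintro _ ⟨t, _, rfl⟩
  exact Real.iSup_nonneg fun r => Real.rpow_nonneg (abs_nonneg _) _

lemma Hfun_spec {n : ℕ} (hn : 1 ≤ n) (γ : ℝ → EuclideanSpace ℝ (Fin n)) (I : Set ℝ)
    (ξ : EuclideanSpace ℝ (Fin n)) {t : ℝ} (ht : t ∈ I) :
    ∃ r < n, (Hfun n γ I ξ) ^ (r + 1) ≤ |∑ i, iteratedDeriv (r + 1) γ t i * ξ i| := by
  have : Nonempty (Fin n) := ⟨⟨0, hn⟩⟩
  have h1 : Hfun n γ I ξ ≤ ⨆ r : Fin n,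
    |∑ i, iteratedDeriv (r.1 + 1) γ t i * ξ i| ^ (((r.1 : ℝ) + 1)⁻¹) := by
    apply csInf_le
    · refine ⟨0, ?_⟩
      rintro _ ⟨t, _, rfl⟩
      exact Real.iSup_nonneg fun r => Real.rpow_nonneg (abs_nonneg _) _
    · exact ⟨t, ht, rfl⟩
  obtain ⟨r, hr⟩ := exists_eq_ciSup_of_finite (f := fun r : Fin n =>
    |∑ i, iteratedDeriv (r.1 + 1) γ t i * ξ i| ^ (((r.1 : ℝ) + 1)⁻¹))
  rw [← hr] at h1
  refine ⟨r.1, r.2, ?_⟩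
  have h2 := pow_le_pow_left₀ (Hfun_nonneg n γ I ξ) h1 (r.1 + 1)
  refine h2.trans (le_of_eq ?_)
  have := Real.rpow_inv_natCast_pow (abs_nonneg (∑ i, iteratedDeriv (r.1 + 1) γ t i * ξ i))
    (Nat.succ_ne_zero r.1)
  simpa using this

/-- For a smooth nondegenerate curve and a smooth bump `w` supported in `[-2,2]`, the weighted
oscillatory integral is dominated by `(1 + H_γ(ξ))⁻¹` for all nonzero frequencies `ξ`. -/
theorem ACK_corollary_weighted
    {n : ℕ} (hn : 1 ≤ n) (γ : ℝ → EuclideanSpace ℝ (Fin n)) (hγ : ContDiff ℝ (⊤ : ℕ∞) γ)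
    (hnondeg : ∀ t ∈ Set.Icc (-2 : ℝ) 2,
      (Matrix.of fun (i r : Fin n) => iteratedDeriv (r.1 + 1) γ t i).det ≠ 0)
    (w : ℝ → ℝ) (hw : ContDiff ℝ (⊤ : ℕ∞) w) (hwc : HasCompactSupport w)
    (hwsupp : tsupport w ⊆ Set.Icc (-2 : ℝ) 2) :
    ∃ C > 0, ∀ ξ : EuclideanSpace ℝ (Fin n), ξ ≠ 0 →
      ‖∫ t : ℝ, Complex.exp (2 * Real.pi * Complex.I * ((∑ i, γ t i * ξ i : ℝ) : ℂ)) * (w t : ℂ)‖ ≤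
        C * (1 + Hfun n γ (Set.Icc (-2 : ℝ) 2) ξ)⁻¹ := by

  obtain ⟨K, hK, hup⟩ := upper_const hγ
  obtain ⟨c, hc, hlow⟩ := lower_const hn hγ hnondeg
  obtain ⟨δ, hδ, C, hC, hshort⟩ := short_bound n (2 * Real.pi * K) c (by positivity) hc
  obtain ⟨m, hm⟩ := exists_nat_gt (4 / δ)
  have hmδ : 4 ≤ m * δ := by
    rw [div_lt_iff₀ hδ] at hm; exact hm.le
  set W : ℝ := |w 2| + ∫ t in (-2 : ℝ)..2, |deriv w t| with hW
  have hW0 : 0 ≤ W := add_nonneg (abs_nonneg _)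
    (intervalIntegral.integral_nonneg (by norm_num) fun _ _ => abs_nonneg _)
  set T : ℝ := 4 * W with hT
  refine ⟨2 * (m * C * W) + 2 * T + 1, by positivity, fun ξ _ => ?_⟩
  set ψ : ℝ → ℝ := fun t => 2 * Real.pi * ∑ i, γ t i * ξ i with hψ
  have hψs : ContDiff ℝ (⊤ : ℕ∞) ψ := by
    simp only [hψ, sum_eq_inner]
    exact contDiff_const.mul (contDiff_const.inner ℝ hγ)
  have hint : (∫ t : ℝ, Complex.exp (2 * Real.pi * Complex.I * ((∑ i, γ t i * ξ i : ℝ) : ℂ)) *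
      (w t : ℂ)) = ∫ t : ℝ, Complex.exp ((ψ t : ℂ) * Complex.I) * (w t : ℂ) := by
    congr 1
    ext t
    congr 2
    simp only [hψ]
    push_cast
    ring
  rw [hint]
  have hH0 := Hfun_nonneg n γ (Set.Icc (-2 : ℝ) 2) ξ
  have hHs := fun t ht => Hfun_spec hn γ (Set.Icc (-2 : ℝ) 2) ξ (t := t) ht
  set H : ℝ := Hfun n γ (Set.Icc (-2 : ℝ) 2) ξ with hH
  have hiter : ∀ r t, |iteratedDeriv r ψ t| =
      2 * Real.pi * |∑ i, iteratedDeriv r γ t i * ξ i| := by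
    intro r t
    rw [hψ, iter_phase hγ ξ r]
    simp only
    rw [abs_mul, abs_of_pos (by positivity : 0 < 2 * Real.pi)]
  have hiter' : ∀ r t, |∑ i, iteratedDeriv r γ t i * ξ i| ≤ |iteratedDeriv r ψ t| := by
    intro r t
    rw [hiter]
    have : 1 ≤ 2 * Real.pi := by linarith [Real.pi_gt_three]
    exact le_mul_of_one_le_left (abs_nonneg _) this
  have hmain : ‖∫ t : ℝ, Complex.exp ((ψ t : ℂ) * Complex.I) * (w t : ℂ)‖ ≤
      (2 * (m * C * W) + 2 * T) * (1 + H)⁻¹ := by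
    rw [← div_eq_mul_inv, le_div_iff₀ (by positivity)]
    have hA0 : 0 ≤ m * C * W := by positivity
    have hT0 : 0 ≤ T := by positivity
    rcases le_total 1 H with h1 | h1
    · have hb := weight_bound (cont_osc hψs) hw hwsupp (B := m * (C / H)) (fun b hb1 hb2 =>
        long_bound (cont_osc hψs) hδ (B := C / H) (div_nonneg hC.le hH0) (fun a b ha hab hb hd =>
          hshort ψ hψs ‖ξ‖ H (norm_nonneg _) h1 (fun t ht r hr => by
              rw [hiter, sum_eq_inner, mul_assoc (2 * Real.pi) K]
              refine mul_le_mul_of_nonneg_left ?_ (by positivity)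
              refine (abs_real_inner_le_norm _ _).trans ?_
              rw [mul_comm]
              exact mul_le_mul_of_nonneg_right (hup t ht r hr) (norm_nonneg _))
            (fun t ht => by
              obtain ⟨r, hr, h⟩ := hlow t ht ξ
              exact ⟨r, hr, h.trans (hiter' _ _)⟩)
            (fun t ht => by
              obtain ⟨r, hr, h⟩ := hHs t ht
              exact ⟨r, hr, h.trans (hiter' _ _)⟩) a b ha hab hb hd) m b hb1 hb2 (by linarith))
      rw [← hW] at hb
      calc _ ≤ m * (C / H) * W * (1 + H) := by gcongr
        _ ≤ m * (C / H) * W * (2 * H) := by gcongr; linarith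
        _ = 2 * (m * C * W) := by field_simp
        _ ≤ _ := by linarith
    · have hb := weight_bound (cont_osc hψs) hw hwsupp (B := 4) (fun b hb1 hb2 =>
        (triv_bound ψ hb1).trans (by linarith))
      rw [← hW] at hb
      calc _ ≤ 4 * W * (1 + H) := by gcongr
        _ ≤ 4 * W * 2 := by gcongr; linarith
        _ ≤ _ := by linarith
  refine hmain.trans ?_
  exact mul_le_mul_of_nonneg_right (by linarith) (by positivity)
end

section
/- Let n ≥ 1 and let γ : ℝ → ℝⁿ be smooth and nondegenerate on [-2,2]. Then there exists a constant C > 0 (depending only on n and γ) such that for every ξ ∈ ℝⁿ: |∫_{-1}^{1} e^{2πi γ(t)·ξ} dt| ≤ C (1 + |ξ|)^{−1/n}, where |ξ| is the Euclidean norm and · is the Euclidean inner product. -/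
open MeasureTheory Real Set

/-- oscillatory integrand -/
noncomputable def vdcE (φ : ℝ → ℝ) (t : ℝ) : ℂ := Complex.exp (Complex.I * (φ t : ℂ))

lemma vdcE_norm (φ : ℝ → ℝ) (t : ℝ) : ‖vdcE φ t‖ = 1 := by
  unfold vdcE
  rw [mul_comm]; exact Complex.norm_exp_ofReal_mul_I _

lemma vdcE_cont {φ : ℝ → ℝ} (h : Continuous φ) : Continuous (vdcE φ) := by
  unfold vdcE; fun_prop

lemma vdcE_triv (φ : ℝ → ℝ) {a b : ℝ} (hab : a ≤ b) :
    ‖∫ t in a..b, vdcE φ t‖ ≤ b - a := by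
  have := intervalIntegral.norm_integral_le_of_norm_le_const (a := a) (b := b) (f := vdcE φ)
    (C := 1) (fun x _ => (vdcE_norm φ x).le)
  rwa [one_mul, abs_of_nonneg (by linarith)] at this

lemma vdc_hd {φ : ℝ → ℝ} (h : ContDiff ℝ (⊤ : ℕ∞) φ) (k : ℕ) (t : ℝ) :
    HasDerivAt (iteratedDeriv k φ) (iteratedDeriv (k+1) φ t) t := by
  rw [iteratedDeriv_succ]
  exact ((h.differentiable_iteratedDeriv k (by exact_mod_cast WithTop.coe_lt_top k)) t).hasDerivAt

lemma vdc_ct {φ : ℝ → ℝ} (h : ContDiff ℝ (⊤ : ℕ∞) φ) (k : ℕ) :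
    Continuous (iteratedDeriv k φ) :=
  continuous_iff_continuousAt.2 fun t => (vdc_hd h k t).continuousAt

lemma vdc_parts {φ : ℝ → ℝ} (h : ContDiff ℝ (⊤ : ℕ∞) φ) {a b l : ℝ} (hab : a ≤ b) (hl : 0 < l)
    (hb : ∀ t ∈ Icc a b, l ≤ |iteratedDeriv 1 φ t|) :
    ‖∫ t in a..b, vdcE φ t‖ ≤
      2 / l + ∫ t in a..b, |iteratedDeriv 2 φ t / (iteratedDeriv 1 φ t) ^ 2| := by
  have hne : ∀ t ∈ uIcc a b, iteratedDeriv 1 φ t ≠ 0 := by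
    intro t ht h0
    rw [uIcc_of_le hab] at ht
    have := hb t ht
    rw [h0, abs_zero] at this; linarith
  have hφ : ∀ t, HasDerivAt φ (iteratedDeriv 1 φ t) t := by
    intro t
    have := vdc_hd h 0 t
    rwa [iteratedDeriv_zero] at this
  set u : ℝ → ℂ := fun t => (((iteratedDeriv 1 φ t)⁻¹ : ℝ) : ℂ) with hu
  set u' : ℝ → ℂ := fun t => ((-(iteratedDeriv 2 φ t) / (iteratedDeriv 1 φ t)^2 : ℝ) : ℂ) with hu'
  set v : ℝ → ℂ := fun t => -Complex.I * vdcE φ t with hv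
  set v' : ℝ → ℂ := fun t => ((iteratedDeriv 1 φ t : ℝ) : ℂ) * vdcE φ t with hv'
  have du : ∀ t ∈ uIcc a b, HasDerivAt u (u' t) t := fun t ht =>
    ((vdc_hd h 1 t).inv (hne t ht)).ofReal_comp
  have dv : ∀ t ∈ uIcc a b, HasDerivAt v (v' t) t := by
    intro t _
    have h1 := (((hφ t).ofReal_comp.const_mul Complex.I).cexp).const_mul (-Complex.I)
    refine h1.congr_deriv ?_
    simp only [hv', vdcE]
    linear_combination (- Complex.exp (Complex.I * (φ t : ℂ)) * ((iteratedDeriv 1 φ t : ℝ) : ℂ)) * Complex.I_sq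
  have cE := vdcE_cont h.continuous
  have c1 := vdc_ct h 1
  have c2 := vdc_ct h 2
  have cu' : ContinuousOn (fun t => -(iteratedDeriv 2 φ t) / (iteratedDeriv 1 φ t)^2) (uIcc a b) :=
    c2.neg.continuousOn.div (c1.pow 2).continuousOn (fun t ht => pow_ne_zero 2 (hne t ht))
  have iu' : IntervalIntegrable u' volume a b :=
    (Complex.continuous_ofReal.comp_continuousOn cu').intervalIntegrable
  have iv' : IntervalIntegrable v' volume a b := by
    apply Continuous.intervalIntegrable
    exact (Complex.continuous_ofReal.comp c1).mul cE
  have key := intervalIntegral.integral_mul_deriv_eq_deriv_mul du dv iu' iv'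
  have e1 : ∫ t in a..b, vdcE φ t = ∫ t in a..b, u t * v' t := by
    apply intervalIntegral.integral_congr
    intro t ht
    have := hne t ht
    have h2 : ((iteratedDeriv 1 φ t : ℝ) : ℂ) ≠ 0 := by exact_mod_cast this
    simp only [hu, hv', Complex.ofReal_inv]
    field_simp
  rw [e1, key]
  have nv : ∀ t, ‖v t‖ = 1 := by intro t; simp [hv, vdcE_norm]
  have nu : ∀ t ∈ Icc a b, ‖u t * v t‖ ≤ 1 / l := by
    intro t ht
    rw [norm_mul, nv, mul_one]
    simp only [hu, Complex.norm_real, norm_inv, Real.norm_eq_abs]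
    rw [inv_eq_one_div]
    exact one_div_le_one_div_of_le hl (hb t ht)
  have n3 : ‖∫ t in a..b, u' t * v t‖ ≤
      ∫ t in a..b, |iteratedDeriv 2 φ t / (iteratedDeriv 1 φ t) ^ 2| := by
    refine (intervalIntegral.norm_integral_le_integral_norm hab).trans (le_of_eq ?_)
    congr 1; ext t
    rw [norm_mul, nv, mul_one]
    simp only [hu', Complex.norm_real, Real.norm_eq_abs, neg_div, abs_neg]
  have na := nu a ⟨le_rfl, hab⟩
  have nb := nu b ⟨hab, le_rfl⟩
  calc _ ≤ ‖u b * v b‖ + ‖u a * v a‖ + ‖∫ t in a..b, u' t * v t‖ :=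
        (norm_sub_le _ _).trans (by gcongr; exact norm_sub_le _ _)
    _ ≤ 1 / l + 1 / l + ∫ t in a..b, |iteratedDeriv 2 φ t / (iteratedDeriv 1 φ t) ^ 2| := by gcongr
    _ = _ := by ring

lemma vdc_cq {φ : ℝ → ℝ} (h : ContDiff ℝ (⊤ : ℕ∞) φ) {a b l : ℝ} (hab : a ≤ b) (hl : 0 < l)
    (hb : ∀ t ∈ Icc a b, l ≤ |iteratedDeriv 1 φ t|) :
    ContinuousOn (fun t => iteratedDeriv 2 φ t / (iteratedDeriv 1 φ t) ^ 2) (uIcc a b) := by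
  refine (vdc_ct h 2).continuousOn.div ((vdc_ct h 1).pow 2).continuousOn fun t ht => ?_
  rw [uIcc_of_le hab] at ht
  have := hb t ht
  have : 0 < |iteratedDeriv 1 φ t| := by linarith
  exact pow_ne_zero 2 (abs_pos.1 this)

lemma vdc_one_bdd {φ : ℝ → ℝ} (h : ContDiff ℝ (⊤ : ℕ∞) φ) {a b l M : ℝ} (hab : a ≤ b) (hl : 0 < l)
    (hb : ∀ t ∈ Icc a b, l ≤ |iteratedDeriv 1 φ t|)
    (hM : ∀ t ∈ Icc a b, |iteratedDeriv 2 φ t| ≤ M) :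
    ‖∫ t in a..b, vdcE φ t‖ ≤ 2 / l + (b - a) * (M / l ^ 2) := by
  refine (vdc_parts h hab hl hb).trans ?_
  gcongr
  have := intervalIntegral.integral_mono_on (μ := volume) hab
    ((vdc_cq h hab hl hb).abs.intervalIntegrable)
    (intervalIntegrable_const (c := M / l ^ 2)) (fun t ht => ?_)
  · rwa [intervalIntegral.integral_const, smul_eq_mul] at this
  · rw [abs_div, abs_pow]
    have h0 := hM t ht
    have := hb t ht
    have := (abs_nonneg _).trans h0
    gcongr

lemma vdc_one_mono {φ : ℝ → ℝ} (h : ContDiff ℝ (⊤ : ℕ∞) φ) {a b l : ℝ} (hab : a ≤ b) (hl : 0 < l)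
    (hb : ∀ t ∈ Icc a b, l ≤ |iteratedDeriv 1 φ t|)
    (hs : (∀ t ∈ Icc a b, 0 ≤ iteratedDeriv 2 φ t) ∨ (∀ t ∈ Icc a b, iteratedDeriv 2 φ t ≤ 0)) :
    ‖∫ t in a..b, vdcE φ t‖ ≤ 4 / l := by
  refine (vdc_parts h hab hl hb).trans ?_
  have hI : ∫ t in a..b, -iteratedDeriv 2 φ t / (iteratedDeriv 1 φ t) ^ 2 =
      (iteratedDeriv 1 φ b)⁻¹ - (iteratedDeriv 1 φ a)⁻¹ := by
    apply intervalIntegral.integral_eq_sub_of_hasDerivAt (f := fun t => (iteratedDeriv 1 φ t)⁻¹)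
    · intro t ht
      rw [uIcc_of_le hab] at ht
      have := hb t ht
      have : 0 < |iteratedDeriv 1 φ t| := by linarith
      exact (vdc_hd h 1 t).inv (abs_pos.1 this)
    · have := (vdc_cq h hab hl hb).neg
      simp only [neg_div]
      exact this.intervalIntegrable
  have hn : ∀ t ∈ Icc a b, |(iteratedDeriv 1 φ t)⁻¹| ≤ 1 / l := by
    intro t ht
    rw [abs_inv, inv_eq_one_div]
    exact one_div_le_one_div_of_le hl (hb t ht)
  have ha := abs_le.1 (hn a ⟨le_rfl, hab⟩)
  have hb' := abs_le.1 (hn b ⟨hab, le_rfl⟩)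
  have e4 : 4 / l = 2 / l + 2 * (1 / l) := by ring
  rw [e4]
  gcongr
  simp only [neg_div] at hI
  rw [intervalIntegral.integral_neg] at hI
  rcases hs with hs | hs
  · have : ∫ t in a..b, |iteratedDeriv 2 φ t / (iteratedDeriv 1 φ t) ^ 2| =
      ∫ t in a..b, iteratedDeriv 2 φ t / (iteratedDeriv 1 φ t) ^ 2 := by
      apply intervalIntegral.integral_congr
      intro t ht
      rw [uIcc_of_le hab] at ht
      exact abs_of_nonneg (div_nonneg (hs t ht) (sq_nonneg _))
    rw [this]; linarith
  · have : ∫ t in a..b, |iteratedDeriv 2 φ t / (iteratedDeriv 1 φ t) ^ 2| =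
      ∫ t in a..b, -(iteratedDeriv 2 φ t / (iteratedDeriv 1 φ t) ^ 2) := by
      apply intervalIntegral.integral_congr
      intro t ht
      rw [uIcc_of_le hab] at ht
      exact abs_of_nonpos (div_nonpos_of_nonpos_of_nonneg (hs t ht) (sq_nonneg _))
    rw [this, intervalIntegral.integral_neg]; linarith

lemma vdc_sign {g : ℝ → ℝ} (hg : Continuous g) {a b : ℝ} (h : ∀ t ∈ Icc a b, g t ≠ 0) :
    (∀ t ∈ Icc a b, 0 ≤ g t) ∨ (∀ t ∈ Icc a b, g t ≤ 0) := by
  by_contra! hc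
  obtain ⟨⟨s, hs, hs0⟩, t, ht, ht0⟩ := hc
  obtain ⟨x, hx, hx0⟩ := isPreconnected_Icc.intermediate_value hs ht hg.continuousOn ⟨hs0.le, ht0.le⟩
  exact h x hx hx0

lemma vdc_main (k : ℕ) : ∃ C : ℝ, 0 < C ∧ ∀ φ : ℝ → ℝ, ContDiff ℝ (⊤ : ℕ∞) φ →
    ∀ a b d : ℝ, a ≤ b → 0 < d →
    (∀ t ∈ Icc a b, 1 ≤ |iteratedDeriv (k+1) φ t| * d ^ (k+1)) →
    (k = 0 → (∀ t ∈ Icc a b, 0 ≤ iteratedDeriv 2 φ t) ∨ (∀ t ∈ Icc a b, iteratedDeriv 2 φ t ≤ 0)) →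
    ‖∫ t in a..b, vdcE φ t‖ ≤ C * d := by
  induction k with
  | zero =>
    refine ⟨4, by norm_num, ?_⟩
    intro φ h a b d hab hd hb hs
    have := vdc_one_mono h hab (inv_pos.2 hd) (fun t ht => ?_) (hs rfl)
    · simpa using this
    · have := hb t ht
      rw [inv_eq_one_div, div_le_iff₀ hd]
      simpa using this
  | succ k ih =>
    obtain ⟨C, hC, ih⟩ := ih
    refine ⟨4 * C + 2, by positivity, ?_⟩
    intro φ h a b d hab hd hb _
    have hne : ∀ t ∈ Icc a b, iteratedDeriv (k+1+1) φ t ≠ 0 := by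
      intro t ht h0
      have := hb t ht
      rw [h0] at this; norm_num at this
    have hsg : k = 0 → ((∀ t ∈ Icc a b, 0 ≤ iteratedDeriv 2 φ t) ∨
        (∀ t ∈ Icc a b, iteratedDeriv 2 φ t ≤ 0)) := by
      rintro rfl
      exact vdc_sign (vdc_ct h 2) hne
    set g := iteratedDeriv (k+1) φ with hg
    obtain ⟨c, hc, hmin⟩ := isCompact_Icc.exists_isMinOn (nonempty_Icc.2 hab)
      ((vdc_ct h (k+1)).abs.continuousOn (s := Icc a b))
    have hmv : ∀ x ∈ Icc a b, ∀ y ∈ Icc a b, x < y → (y - x) ≤ |g y - g x| * d ^ (k+1+1) := by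
      intro x hx y hy hxy
      obtain ⟨z, hz, hz'⟩ := exists_hasDerivAt_eq_slope g (iteratedDeriv (k+1+1) φ) hxy
        (vdc_ct h (k+1)).continuousOn (fun z _ => vdc_hd h (k+1) z)
      have h1 := hb z ⟨hx.1.trans hz.1.le, hz.2.le.trans hy.2⟩
      have hp : 0 < y - x := by linarith
      rw [hz', abs_div, abs_of_pos hp, div_mul_eq_mul_div, le_div_iff₀ hp] at h1
      linarith
    have hfar : ∀ t ∈ Icc a b, d ≤ |t - c| → 1 ≤ |g t| * (2 * d) ^ (k+1) := by
      intro t ht htd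
      have hm : |g c| ≤ |g t| := hmin ht
      have h1 : |t - c| ≤ |g t - g c| * d ^ (k+1+1) := by
        rcases lt_trichotomy t c with hlt | heq | hgt
        · have := hmv t ht c hc hlt
          rwa [abs_sub_comm, abs_sub_comm (g t), abs_of_pos (sub_pos.2 hlt)]
        · subst heq; simp
        · have := hmv c hc t ht hgt
          rwa [abs_of_pos (sub_pos.2 hgt)]
      have h2 : |g t - g c| ≤ 2 * |g t| := by
        have := abs_sub (g t) (g c); linarith
      have h3 : d ≤ 2 * |g t| * d ^ (k+1+1) :=
        (htd.trans h1).trans (by gcongr)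
      have h4 : 1 ≤ 2 * |g t| * d ^ (k+1) := by
        rw [pow_succ] at h3
        by_contra! hlt
        nlinarith
      have h5 : (2:ℝ) ≤ 2 ^ (k+1) := by
        calc (2:ℝ) = 2 ^ 1 := by norm_num
          _ ≤ _ := pow_le_pow_right₀ (by norm_num) (by omega)
      rw [mul_pow]
      have h6 : 0 ≤ |g t| * d ^ (k+1) := by positivity
      nlinarith
    have hsub : ∀ p q, a ≤ p → p ≤ q → q ≤ b → (∀ t ∈ Icc p q, d ≤ |t - c|) →
        ‖∫ t in p..q, vdcE φ t‖ ≤ C * (2 * d) := by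
      intro p q hap hpq hqb hd'
      have hin : ∀ t ∈ Icc p q, t ∈ Icc a b := fun t ht => ⟨hap.trans ht.1, ht.2.trans hqb⟩
      refine ih φ h p q (2 * d) hpq (by positivity) (fun t ht => hfar t (hin t ht) (hd' t ht)) ?_
      intro hk
      exact (hsg hk).imp (fun H t ht => H t (hin t ht)) (fun H t ht => H t (hin t ht))
    have hint : ∀ p q, IntervalIntegrable (vdcE φ) volume p q := fun p q =>
      (vdcE_cont h.continuous).intervalIntegrable p q
    set p := max a (c - d) with hp
    set q := min b (c + d) with hq
    have hap : a ≤ p := le_max_left _ _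
    have hqb : q ≤ b := min_le_left _ _
    have hpc : p ≤ c := max_le hc.1 (by linarith)
    have hcq : c ≤ q := le_min hc.2 (by linarith)
    have hp2 : c - d ≤ p := le_max_right _ _
    have hq2 : q ≤ c + d := min_le_right _ _
    have I1 : ‖∫ t in a..p, vdcE φ t‖ ≤ C * (2 * d) := by
      rcases le_total a (c - d) with hh | hh
      · have : p = c - d := max_eq_right hh
        refine hsub a p le_rfl hap (hpc.trans hc.2) fun t ht => ?_
        rw [abs_sub_comm]
        exact le_trans (by linarith [ht.2]) (le_abs_self _)
      · have : p = a := max_eq_left hh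
        rw [this]; simp; positivity
    have I3 : ‖∫ t in q..b, vdcE φ t‖ ≤ C * (2 * d) := by
      rcases le_total b (c + d) with hh | hh
      · have : q = b := min_eq_left hh
        rw [this]; simp; positivity
      · have : q = c + d := min_eq_right hh
        refine hsub q b (hc.1.trans hcq) hqb le_rfl fun t ht => ?_
        exact le_trans (by linarith [ht.1]) (le_abs_self _)
    have I2 := vdcE_triv φ (hpc.trans hcq)
    rw [← intervalIntegral.integral_add_adjacent_intervals (hint a p) (hint p b),
      ← intervalIntegral.integral_add_adjacent_intervals (hint p q) (hint q b)]
    have n1 := norm_add_le (∫ t in a..p, vdcE φ t) ((∫ t in p..q, vdcE φ t) + ∫ t in q..b, vdcE φ t)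
    have n2 := norm_add_le (∫ t in p..q, vdcE φ t) (∫ t in q..b, vdcE φ t)
    linarith

lemma vdc_chop {φ : ℝ → ℝ} (h : Continuous φ) {w B : ℝ} (hw : 0 < w) (hB : 0 ≤ B) {β : ℝ} (N : ℕ) :
    ∀ α, (∀ a b, α ≤ a → a ≤ b → b ≤ β → b - a ≤ w → ‖∫ t in a..b, vdcE φ t‖ ≤ B) →
    α ≤ β → β - α ≤ N * w → ‖∫ t in α..β, vdcE φ t‖ ≤ N * B := by
  induction N with
  | zero =>
    intro α _ h1 h2
    have : α = β := by simp at h2; linarith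
    subst this; simp
  | succ N ih =>
    intro α H h1 h2
    push_cast at h2 ⊢
    rcases le_total (β - α) w with hh | hh
    · have := H α β le_rfl h1 le_rfl hh
      nlinarith [mul_nonneg (Nat.cast_nonneg (α := ℝ) N) hB]
    · have A := H α (α + w) le_rfl (by linarith) (by linarith) (by linarith)
      have A2 := ih (α + w) (fun a b h1 h2 h3 h4 => H a b (by linarith) h2 h3 h4)
        (by linarith) (by linarith)
      have hi : ∀ p q, IntervalIntegrable (vdcE φ) volume p q := fun p q =>
        (vdcE_cont h).intervalIntegrable p q
      rw [← intervalIntegral.integral_add_adjacent_intervals (hi α (α + w)) (hi (α + w) β)]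
      refine (norm_add_le _ _).trans ?_
      linarith

lemma vdc_final {n : ℕ} (hn : 1 ≤ n) {c M : ℝ} (hc : 0 < c) (hM : 0 < M) :
    ∃ C > 0, ∀ φ : ℝ → ℝ, ContDiff ℝ (⊤ : ℕ∞) φ → ∀ L : ℝ, 1 ≤ L →
      (∀ t ∈ Icc (-1 : ℝ) 1, ∃ r < n, c * L ≤ |iteratedDeriv (r+1) φ t|) →
      (∀ r ≤ n, ∀ t ∈ Icc (-1 : ℝ) 1, |iteratedDeriv (r+1) φ t| ≤ M * L) →
      ‖∫ t in (-1 : ℝ)..1, vdcE φ t‖ ≤ C * (1 + L) ^ (-(n : ℝ)⁻¹) := by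
  choose Cf hCf hmain using vdc_main
  set Cs := ∑ k ∈ Finset.range n, Cf k with hCs
  have hCle : ∀ k < n, Cf k ≤ Cs := fun k hk =>
    Finset.single_le_sum (f := Cf) (fun i _ => (hCf i).le) (Finset.mem_range.2 hk)
  have hCs0 : 0 < Cs := (hCf 0).trans_le (hCle 0 (by omega))
  set e := c / 2 with he
  have he0 : 0 < e := by positivity
  set w := e / M with hw
  have hw0 : 0 < w := by positivity
  set K := max 1 (2 / e) with hK
  have hK1 : 1 ≤ K := le_max_left _ _
  have hK2 : 2 / e ≤ K := le_max_right _ _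
  set A := Cs * K + 2 * (2 / e + 2 * M / e ^ 2) with hA
  have hA0 : 0 < A := by positivity
  set N := ⌈2 / w⌉₊ with hN
  have hN2 : 2 ≤ N * w := by
    have := Nat.le_ceil (2 / w)
    rwa [div_le_iff₀ hw0] at this
  have hN0 : (0:ℝ) < N := by
    by_contra! h
    nlinarith
  refine ⟨N * A, by positivity, ?_⟩
  intro φ h L hL hlow hup
  set ρ := (1 + L) ^ (-(n : ℝ)⁻¹) with hρ
  have hL0 : 0 < L := by linarith
  have hρ0 : 0 < ρ := by positivity
  have hρ1 : ρ ≤ 1 := Real.rpow_le_one_of_one_le_of_nonpos (by linarith)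
    (neg_nonpos.2 (by positivity))
  have hn0 : (n : ℝ) ≠ 0 := by positivity
  have hρn : ρ ^ n = (1 + L)⁻¹ := by
    rw [hρ, ← Real.rpow_natCast, ← Real.rpow_mul (by linarith), neg_mul, inv_mul_cancel₀ hn0,
      Real.rpow_neg_one]
  have hρk : ∀ k, 1 ≤ k → k ≤ n → (1 + L)⁻¹ ≤ ρ ^ k := fun k _ hk => by
    rw [← hρn]; exact pow_le_pow_of_le_one hρ0.le hρ1 hk
  have hinvL : 1 / L ≤ 2 * ρ := by
    have h1 := hρk 1 le_rfl hn
    rw [pow_one] at h1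
    have : 1 / L ≤ 2 * (1 + L)⁻¹ := by
      rw [← div_eq_mul_inv, div_le_div_iff₀ hL0 (by linarith)]; linarith
    linarith
  rw [mul_assoc]
  refine vdc_chop h.continuous hw0 (by positivity) N (-1) ?_ (by norm_num) (by linarith)
  intro a b ha hab hb hbw
  have hin : ∀ t ∈ Icc a b, t ∈ Icc (-1 : ℝ) 1 := fun t ht => ⟨ha.trans ht.1, ht.2.trans hb⟩
  obtain ⟨r, hr, hra⟩ := hlow a (hin a ⟨le_rfl, hab⟩)
  have hbig : ∀ t ∈ Icc a b, e * L ≤ |iteratedDeriv (r+1) φ t| := by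
    intro t ht
    have h1 := Convex.norm_image_sub_le_of_norm_deriv_le (f := iteratedDeriv (r+1) φ)
      (s := Icc a b) (C := M * L) (x := a) (y := t)
      (fun x _ => (vdc_hd h (r+1) x).differentiableAt)
      (fun x hx => by
        rw [(vdc_hd h (r+1) x).deriv]; exact hup (r+1) (by omega) x (hin x hx))
      (convex_Icc a b) ⟨le_rfl, hab⟩ ht
    rw [Real.norm_eq_abs, Real.norm_eq_abs, abs_of_nonneg (sub_nonneg.2 ht.1)] at h1
    have h2 : M * L * (t - a) ≤ M * L * w := by
      have := ht.2
      gcongr; linarith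
    have h3 : M * L * w = e * L := by rw [hw]; field_simp
    have h4 : |iteratedDeriv (r+1) φ a| - |iteratedDeriv (r+1) φ t| ≤
      |iteratedDeriv (r+1) φ t - iteratedDeriv (r+1) φ a| := by
      rw [abs_sub_comm]; exact abs_sub_abs_le_abs_sub _ _
    have h5 : c = 2 * e := by rw [he]; ring
    rw [h5] at hra
    linarith
  rcases Nat.eq_zero_or_pos r with rfl | hr0
  · have h1 := vdc_one_bdd h hab (by positivity : 0 < e * L) hbig
      (fun t ht => hup 1 hn t (hin t ht))
    have h2 : (b - a) * (M * L / (e * L) ^ 2) ≤ 2 * (M * L / (e * L) ^ 2) := by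
      gcongr; linarith
    have h3 : 2 / (e * L) + 2 * (M * L / (e * L) ^ 2) = (2 / e + 2 * M / e ^ 2) * (1 / L) := by
      field_simp
    have h4 : (2 / e + 2 * M / e ^ 2) * (1 / L) ≤ (2 / e + 2 * M / e ^ 2) * (2 * ρ) := by gcongr
    have h5 : 0 ≤ Cs * K * ρ := by positivity
    rw [hA, add_mul]
    linarith
  · have h1 := hmain r φ h a b (K * ρ) hab (by positivity) (fun t ht => ?_) (by omega)
    · refine h1.trans ?_
      have h2 : Cf r * (K * ρ) ≤ Cs * (K * ρ) := by gcongr; exact hCle r hr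
      have h5 : 0 ≤ 2 * (2 / e + 2 * M / e ^ 2) * ρ := by positivity
      rw [hA, add_mul]
      linarith
    · have h2 := hbig t ht
      have h3 : K * (1 + L)⁻¹ ≤ (K * ρ) ^ (r+1) := by
        rw [mul_pow]
        have h4 := hρk (r+1) (by omega) (by omega)
        have h5 : K ≤ K ^ (r+1) := le_self_pow₀ hK1 (by omega)
        gcongr
      calc (1:ℝ) ≤ (e * L) * (2 / e * (1 + L)⁻¹) := by
            have : (e * L) * (2 / e * (1 + L)⁻¹) = 2 * L / (1 + L) := by field_simp
            rw [this, le_div_iff₀ (by linarith)]; linarith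
        _ ≤ (e * L) * (K * (1 + L)⁻¹) := by gcongr
        _ ≤ _ := by gcongr

lemma vdc_phase {n : ℕ} {γ : ℝ → EuclideanSpace ℝ (Fin n)} (hγ : ContDiff ℝ (⊤ : ℕ∞) γ)
    (ξ : EuclideanSpace ℝ (Fin n)) (k : ℕ) :
    iteratedDeriv k (fun t => 2 * π * inner ℝ ξ (γ t)) =
      fun t => 2 * π * inner ℝ ξ (iteratedDeriv k γ t) := by
  induction k with
  | zero => simp
  | succ k ih =>
    rw [iteratedDeriv_succ, ih]
    ext t
    have h1 : HasDerivAt (iteratedDeriv k γ) (iteratedDeriv (k+1) γ t) t := by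
      rw [iteratedDeriv_succ]
      exact ((hγ.differentiable_iteratedDeriv k
        (by exact_mod_cast WithTop.coe_lt_top k)) t).hasDerivAt
    have h2 := ((innerSL ℝ ξ).hasFDerivAt.comp_hasDerivAt t h1).const_mul (2 * π)
    exact h2.deriv

lemma vdc_lower {n : ℕ} (hn : 1 ≤ n) (γ : ℝ → EuclideanSpace ℝ (Fin n))
    (hγ : ContDiff ℝ (⊤ : ℕ∞) γ)
    (hnondeg : ∀ t ∈ Set.Icc (-2 : ℝ) 2,
      (Matrix.of fun (i r : Fin n) => iteratedDeriv (r.1 + 1) γ t i).det ≠ 0) :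
    ∃ c > 0, ∀ t ∈ Icc (-1 : ℝ) 1, ∀ ξ : EuclideanSpace ℝ (Fin n),
      ∃ r < n, c * ‖ξ‖ ≤ |inner ℝ ξ (iteratedDeriv (r+1) γ t)| := by
  have hcont : ∀ k, Continuous (iteratedDeriv k γ) := fun k =>
    hγ.continuous_iteratedDeriv k (by exact_mod_cast le_top)
  set G : ℝ × EuclideanSpace ℝ (Fin n) → ℝ := fun p =>
    ∑ r : Fin n, |inner ℝ p.2 (iteratedDeriv (r.1+1) γ p.1)| with hG
  have hGc : Continuous G := by
    refine continuous_finsetSum _ fun r _ => ?_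
    exact (continuous_snd.inner ((hcont _).comp continuous_fst)).abs
  have hGpos : ∀ p ∈ Icc (-1 : ℝ) 1 ×ˢ Metric.sphere (0 : EuclideanSpace ℝ (Fin n)) 1,
      0 < G p := by
    rintro ⟨t, ξ⟩ ⟨ht, hξ⟩
    refine lt_of_le_of_ne (Finset.sum_nonneg fun _ _ => abs_nonneg _) fun h0 => ?_
    have hz := (Finset.sum_eq_zero_iff_of_nonneg (fun _ _ => abs_nonneg _)).1 h0.symm
    have hdet := hnondeg t ⟨by linarith [ht.1], by linarith [ht.2]⟩
    have hv : Matrix.vecMul (fun i => ξ i)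
        (Matrix.of fun (i r : Fin n) => iteratedDeriv (r.1 + 1) γ t i) = 0 := by
      ext r
      have := abs_eq_zero.1 (hz r (Finset.mem_univ _))
      simp only [PiLp.inner_apply, RCLike.inner_apply, conj_trivial] at this
      simp only [Matrix.vecMul, dotProduct, Matrix.of_apply, Pi.zero_apply]
      rw [← this]
      exact Finset.sum_congr rfl fun i _ => mul_comm _ _
    have := Matrix.eq_zero_of_vecMul_eq_zero hdet hv
    have hξ0 : ξ = 0 := by
      ext i; exact congrFun this i
    rw [hξ0] at hξ
    simp at hξ
  obtain ⟨c, hc, hcG⟩ := (isCompact_Icc.prod (isCompact_sphere _ _)).exists_forall_le'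
    hGc.continuousOn hGpos
  have hn0 : (0:ℝ) < n := by exact_mod_cast hn
  refine ⟨c / n, by positivity, ?_⟩
  intro t ht ξ
  rcases eq_or_ne ξ 0 with rfl | hξ
  · exact ⟨0, by omega, by simp⟩
  have hp : 0 < ‖ξ‖ := norm_pos_iff.2 hξ
  have h1 := hcG (t, ‖ξ‖⁻¹ • ξ) ⟨ht, by simp [norm_smul, hp.ne']⟩
  have h2 : G (t, ‖ξ‖⁻¹ • ξ) = ‖ξ‖⁻¹ * ∑ r : Fin n, |inner ℝ ξ (iteratedDeriv (r.1+1) γ t)| := by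
    simp only [hG, inner_smul_left, abs_mul, Finset.mul_sum]
    simp
  rw [h2, inv_mul_eq_div, le_div_iff₀ hp] at h1
  have : Nonempty (Fin n) := ⟨⟨0, hn⟩⟩
  obtain ⟨r, _, hr⟩ := Finset.exists_le_of_sum_le (s := (Finset.univ : Finset (Fin n)))
    (f := fun _ => c / n * ‖ξ‖) (g := fun r => |inner ℝ ξ (iteratedDeriv (r.1+1) γ t)|)
    Finset.univ_nonempty (by
      refine le_trans (le_of_eq ?_) h1
      simp; field_simp)
  exact ⟨r.1, r.2, hr⟩

/-- Van der Corput estimate for a smooth nondegenerate curve: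
`|∫_{-1}^{1} e^{2πi γ(t)·ξ} dt| ≤ C (1 + |ξ|)^{−1/n}`. -/
theorem van_der_Corput_nondegenerate_curve
    {n : ℕ} (hn : 1 ≤ n) (γ : ℝ → EuclideanSpace ℝ (Fin n)) (hγ : ContDiff ℝ (⊤ : ℕ∞) γ)
    (hnondeg : ∀ t ∈ Set.Icc (-2 : ℝ) 2,
      (Matrix.of fun (i r : Fin n) => iteratedDeriv (r.1 + 1) γ t i).det ≠ 0) :
    ∃ C > 0, ∀ ξ : EuclideanSpace ℝ (Fin n),
      ‖∫ t in Set.Icc (-1 : ℝ) 1,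
          Complex.exp (2 * Real.pi * Complex.I * ((∑ i, γ t i * ξ i : ℝ) : ℂ))‖ ≤
        C * (1 + ‖ξ‖) ^ (-(n : ℝ)⁻¹) := by
  have hcont : ∀ k, Continuous (iteratedDeriv k γ) := fun k =>
    hγ.continuous_iteratedDeriv k (by exact_mod_cast le_top)
  obtain ⟨c, hc, hlow⟩ := vdc_lower hn γ hγ hnondeg
  have hbd : ∀ k, ∃ M > 0, ∀ t ∈ Icc (-1 : ℝ) 1, ‖iteratedDeriv k γ t‖ ≤ M := by
    intro k
    obtain ⟨M, hM⟩ := isCompact_Icc.exists_bound_of_continuousOn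
      ((hcont k).continuousOn (s := Icc (-1 : ℝ) 1))
    exact ⟨max M 1, by positivity, fun t ht => (hM t ht).trans (le_max_left _ _)⟩
  choose Mf hMf hMb using hbd
  set M := ∑ k ∈ Finset.range (n+2), Mf k with hMdef
  have hMle : ∀ k < n + 2, Mf k ≤ M := fun k hk =>
    Finset.single_le_sum (f := Mf) (fun i _ => (hMf i).le) (Finset.mem_range.2 hk)
  have hM0 : 0 < M := (hMf 0).trans_le (hMle 0 (by omega))
  have hpi := Real.pi_pos
  obtain ⟨C, hC, hfin⟩ := vdc_final hn (c := 2 * π * c) (M := 2 * π * M)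
    (by positivity) (by positivity)
  refine ⟨max C 4, by positivity, fun ξ => ?_⟩
  set φ : ℝ → ℝ := fun t => 2 * π * inner ℝ ξ (γ t) with hφ
  have hφs : ContDiff ℝ (⊤ : ℕ∞) φ := contDiff_const.mul (contDiff_const.inner ℝ hγ)
  have hI : ∫ t in Set.Icc (-1 : ℝ) 1,
          Complex.exp (2 * Real.pi * Complex.I * ((∑ i, γ t i * ξ i : ℝ) : ℂ)) =
      ∫ t in (-1 : ℝ)..1, vdcE φ t := by
    rw [intervalIntegral.integral_of_le (by norm_num), integral_Icc_eq_integral_Ioc]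
    congr 1
    ext t
    have : φ t = 2 * π * ∑ i, γ t i * ξ i := by
      simp [hφ, PiLp.inner_apply]
    rw [vdcE, this]
    congr 1
    push_cast
    ring
  rw [hI]
  have hρ0 : 0 < (1 + ‖ξ‖) ^ (-(n : ℝ)⁻¹) := by positivity
  rcases le_total 1 ‖ξ‖ with h1 | h1
  · refine (hfin φ hφs ‖ξ‖ h1 ?_ ?_).trans (by gcongr; exact le_max_left _ _)
    · intro t ht
      obtain ⟨r, hr, hrt⟩ := hlow t ht ξ
      refine ⟨r, hr, ?_⟩
      rw [hφ, vdc_phase hγ]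
      simp only
      rw [abs_mul, abs_of_pos (by positivity : 0 < 2 * π), mul_assoc]
      gcongr
    · intro r hr t ht
      rw [hφ, vdc_phase hγ]
      simp only
      rw [abs_mul, abs_of_pos (by positivity : 0 < 2 * π), mul_assoc (2 * π) M]
      gcongr
      refine (abs_real_inner_le_norm ξ (iteratedDeriv (r+1) γ t)).trans ?_
      rw [mul_comm]
      gcongr
      exact (hMb _ t ht).trans (hMle _ (by omega))
  · have h2 := vdcE_triv φ (by norm_num : (-1 : ℝ) ≤ 1)
    have h3 : (1 + ‖ξ‖) ^ (-1 : ℝ) ≤ (1 + ‖ξ‖) ^ (-(n : ℝ)⁻¹) := by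
      apply Real.rpow_le_rpow_of_exponent_le (by linarith [norm_nonneg ξ])
      have : (n : ℝ)⁻¹ ≤ 1 := inv_le_one_of_one_le₀ (by exact_mod_cast hn)
      linarith
    rw [Real.rpow_neg_one] at h3
    have h4 : (2:ℝ)⁻¹ ≤ (1 + ‖ξ‖)⁻¹ := by
      have := norm_nonneg ξ
      gcongr; linarith
    have h5 : 4 * (1 + ‖ξ‖) ^ (-(n : ℝ)⁻¹) ≤ max C 4 * (1 + ‖ξ‖) ^ (-(n : ℝ)⁻¹) := by
      gcongr; exact le_max_right _ _
    linarith
end
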